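/- Suppose both ⟨·,·⟩₁ and ⟨·,·⟩₂ are bi-invariant, i.e. ⟨[X,Y],Z⟩ᵢ = ⟨X,[Y,Z]⟩ᵢ for all X,Y,Z ∈ 𝔤 and i = 1,2. Then for all X,Y ∈ 𝔤: ∇̃_{X^v}Y^v = 0, ∇̃_{X^c}Y^c = ½[X,Y]^c, ∇̃_{X^v}Y^c = 0, and ∇̃_{X^c}Y^v = [X,Y]^v. -/

import Mathlib

/-- `g` is an inner product (symmetric positive-definite bilinear form) on a real vector space. -/
structure IsInnerProd {L : Type*} [AddCommGroup L] [Module ℝ L] (g : L → L → ℝ) : Prop where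
  addLeft : ∀ x y z : L, g (x + y) z = g x z + g y z
  smulLeft : ∀ (a : ℝ) (x y : L), g (a • x) y = a * g x y
  symm : ∀ x y : L, g x y = g y x
  posDef : ∀ x : L, x ≠ 0 → 0 < g x x

/-- The bracket of the tangent Lie algebra `T𝔤 = 𝔤 × 𝔤`:
`[(X₁,Y₁),(X₂,Y₂)] = ([X₁,X₂], [X₁,Y₂] + [Y₁,X₂])`.
The complete lift of `X` is `(X, 0)` and the vertical lift is `(0, X)`. -/
def tbr {L : Type*} [LieRing L] (A B : L × L) : L × L :=
  (⁅A.1, B.1⁆, ⁅A.1, B.2⁆ + ⁅A.2, B.1⁆)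

/-- The lifted inner product `g̃` on `T𝔤 = 𝔤 × 𝔤` determined by
`g̃(X^c,Y^c) = ⟨X,Y⟩₁`, `g̃(X^v,Y^v) = ⟨X,Y⟩₂`, `g̃(X^c,Y^v) = 0`. -/
def tg {L : Type*} (g1 g2 : L → L → ℝ) (A B : L × L) : ℝ :=
  g1 A.1 B.1 + g2 A.2 B.2

/-- `nab` is the Levi-Civita connection of the metric `g` with respect to the bracket `br`,
i.e. it satisfies the Koszul formula
`2⟨∇_X Y, Z⟩ = ⟨[X,Y],Z⟩ − ⟨[Y,Z],X⟩ + ⟨[Z,X],Y⟩`. -/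
def IsLC {V : Type*} [AddCommGroup V] [Module ℝ V] (br : V → V → V)
    (g : V → V → ℝ) (nab : V → V → V) : Prop :=
  ∀ X Y Z : V, 2 * g (nab X Y) Z = g (br X Y) Z - g (br Y Z) X + g (br Z X) Y

/-- The curvature tensor `R(X,Y)Z = ∇_X ∇_Y Z − ∇_Y ∇_X Z − ∇_{[X,Y]} Z`. -/
def curvOf {V : Type*} [AddCommGroup V] (br nab : V → V → V) (X Y Z : V) : V :=
  nab X (nab Y Z) - nab Y (nab X Z) - nab (br X Y) Z

namespace IsInnerProd

variable {V : Type*} [AddCommGroup V] [Module ℝ V] {g : V → V → ℝ}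

theorem zero_left (hg : IsInnerProd g) (z : V) : g 0 z = 0 := by
  have h := hg.addLeft 0 0 z
  rw [add_zero] at h
  linarith

theorem zero_right (hg : IsInnerProd g) (z : V) : g z 0 = 0 := by
  rw [hg.symm, hg.zero_left]

theorem sub_left (hg : IsInnerProd g) (x y z : V) : g (x - y) z = g x z - g y z := by
  have h := hg.addLeft (x - y) y z
  rw [sub_add_cancel] at h
  linarith

theorem ext_left (hg : IsInnerProd g) {x y : V} (h : ∀ z, g x z = g y z) : x = y := by
  by_contra hne
  have hpos := hg.posDef (x - y) (sub_ne_zero.mpr hne)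
  rw [hg.sub_left, h, sub_self] at hpos
  exact lt_irrefl 0 hpos

theorem nonneg (hg : IsInnerProd g) (x : V) : 0 ≤ g x x := by
  rcases eq_or_ne x 0 with rfl | hx
  · exact (hg.zero_left 0).ge
  · exact (hg.posDef x hx).le

/-- The lifted form `g̃` on `T𝔤` is again an inner product. -/
theorem tg {g1 g2 : V → V → ℝ} (hg1 : IsInnerProd g1) (hg2 : IsInnerProd g2) :
    IsInnerProd (tg g1 g2) where
  addLeft x y z := by
    simp only [_root_.tg, Prod.fst_add, Prod.snd_add, hg1.addLeft, hg2.addLeft]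
    ring
  smulLeft a x y := by
    simp only [_root_.tg, Prod.smul_fst, Prod.smul_snd, hg1.smulLeft, hg2.smulLeft]
    ring
  symm x y := by
    simp only [_root_.tg, hg1.symm x.1, hg2.symm x.2]
  posDef x hx := by
    rcases eq_or_ne x.1 0 with h1 | h1
    · have h2 : x.2 ≠ 0 := fun h2 => hx (Prod.ext h1 h2)
      exact add_pos_of_nonneg_of_pos (hg1.nonneg _) (hg2.posDef _ h2)
    · exact add_pos_of_pos_of_nonneg (hg1.posDef _ h1) (hg2.nonneg _)

/-- A Levi-Civita connection is determined by the Koszul formula. -/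
theorem eq_of_koszul (hg : IsInnerProd g) {br nab : V → V → V} (hn : IsLC br g nab) {X Y W : V}
    (h : ∀ Z, g (br X Y) Z - g (br Y Z) X + g (br Z X) Y = 2 * g W Z) : nab X Y = W :=
  hg.ext_left fun Z => by linarith [hn X Y Z, h Z]

end IsInnerProd

theorem statement8 {L : Type*} [LieRing L] [Module ℝ L] [LieAlgebra ℝ L]
    [FiniteDimensional ℝ L]
    (g1 g2 : L → L → ℝ) (hg1 : IsInnerProd g1) (hg2 : IsInnerProd g2)
    (nabla1 nabla2 : L → L → L)
    (hn1 : IsLC (fun X Y : L => ⁅X, Y⁆) g1 nabla1)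
    (hn2 : IsLC (fun X Y : L => ⁅X, Y⁆) g2 nabla2)
    (tnabla : L × L → L × L → L × L)
    (htn : IsLC tbr (tg g1 g2) tnabla)
    (hbi1 : ∀ X Y Z : L, g1 ⁅X, Y⁆ Z = g1 X ⁅Y, Z⁆)
    (hbi2 : ∀ X Y Z : L, g2 ⁅X, Y⁆ Z = g2 X ⁅Y, Z⁆) :
    ∀ X Y : L,
      tnabla (0, X) (0, Y) = 0 ∧
      tnabla (X, 0) (Y, 0) = (((1 : ℝ) / 2) • ⁅X, Y⁆, (0 : L)) ∧
      tnabla (0, X) (Y, 0) = 0 ∧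
      tnabla (X, 0) (0, Y) = ((0 : L), ⁅X, Y⁆) := by
  have hg := hg1.tg hg2
  have cyc1 (X Y Z : L) : g1 ⁅Y, Z⁆ X = g1 ⁅X, Y⁆ Z := by rw [hg1.symm, hbi1]
  have cyc2 (X Y Z : L) : g2 ⁅Y, Z⁆ X = g2 ⁅X, Y⁆ Z := by rw [hg2.symm, hbi2]
  intro X Y
  refine ⟨hg.eq_of_koszul htn fun Z => ?_, hg.eq_of_koszul htn fun Z => ?_,
    hg.eq_of_koszul htn fun Z => ?_, hg.eq_of_koszul htn fun Z => ?_⟩ <;>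
  simp only [tg, tbr, zero_lie, lie_zero, add_zero, zero_add, hg1.zero_left, hg2.zero_left,
    hg1.zero_right, hg2.zero_right, Prod.fst_zero, Prod.snd_zero, hg1.smulLeft]
  · linarith [cyc2 X Y Z.1, cyc2 Y Z.1 X]
  · linarith [cyc1 X Y Z.1, cyc1 Y Z.1 X]
  · linarith [cyc2 X Y Z.2]
  · linarith [cyc2 Y Z.2 X, cyc2 X Y Z.2]
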